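/- Glauber expansion of the Dirichlet energy (Lemma 3.3 of the paper, on a general finite graph): let (V, ∼) be a finite simple graph with edge set E and interior set V₀ ⊆ V, let ℓ : V → ℝ, and let v : {0,1}^E → (V → ℝ) be a family of functions such that for every configuration b ∈ {0,1}^E, v(b) = ℓ on V ∖ V₀ and v(b) is b-harmonic at every x ∈ V₀. Define ℰ : {0,1}^E → ℝ by ℰ(b) := ⟨∇v(b), b·∇v(b)⟩. Then for every k ≥ 1 and every configuration a ∈ {0,1}^E: ∑_{F ⊆ E, |F| = k} (D_F ℰ)(a) = ⟨∇ℓ, a · ∑_{F ⊆ E, |F| = k} ∇((D_F v)(a))⟩ + ∑_{e ∈ E} ⟨∇ℓ, (a^e − a) · ∑_{G ⊆ E, |G| = k−1} ∇((D_G v)(a^e))⟩, where Glauber derivatives of function-valued maps are taken pointwise in V, and (a^e − a)·W denotes multiplying the edge field W by the {0,1}-valued edge weight (a^e − a). -/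

import Mathlib

noncomputable section

open Finset

variable {E : Type*} [DecidableEq E]

/-- The configuration obtained from `a` by opening all the bonds in `G` (`a^G` in the paper). -/
def opn (a : E → Bool) (G : Finset E) : E → Bool := fun e => if e ∈ G then true else a e

/-- The Glauber derivative with respect to a single bond: `(D_e f)(a) = f(a^e) − f(a)`. -/
def D1 {β : Type*} [AddCommGroup β] (e : E) (f : (E → Bool) → β) : (E → Bool) → β :=
  fun a => f (opn a {e}) - f a

/-- The iterated Glauber derivative `D_G = D_{e₁} ∘ ⋯ ∘ D_{eₙ}` for `G = {e₁, …, eₙ}`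
(well defined independently of the order since the operators `D_e` commute); `D_∅ f = f`. -/
def DG {β : Type*} [AddCommGroup β] (G : Finset E) (f : (E → Bool) → β) : (E → Bool) → β :=
  G.toList.foldr D1 f

/-- The real-valued edge weight of a configuration `b : E → {0,1}` on the edge set of a
finite simple graph: `ew G b x y = b({x,y})` if `x ∼ y`, and `0` otherwise.  With this
weight, `∑_y ew G b x y * (u y − u x) = ∑_{y ∼ x} b({x,y}) ∇u(x,y)`, and
`(1/2) ∑_x ∑_y ew G b x y * F x y * H x y = ⟨F, b·H⟩ = ∑_{{x,y} ∈ E} b({x,y}) F x y H x y`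
(one summand per unordered edge). -/
def ew {V : Type*} (G : SimpleGraph V) [DecidableRel G.Adj]
    (b : G.edgeSet → Bool) (x y : V) : ℝ :=
  if h : G.Adj x y then (if b ⟨s(x, y), (G.mem_edgeSet).mpr h⟩ then 1 else 0) else 0


theorem opn_comm' (a : E → Bool) (e f : E) : opn (opn a {e}) {f} = opn (opn a {f}) {e} := by
  funext x; simp only [opn]; split_ifs <;> rfl

theorem opn_idem' (a : E → Bool) (e : E) : opn (opn a {e}) {e} = opn a {e} := by
  funext x; simp only [opn]; split_ifs <;> rfl

theorem D1_comm' {β : Type*} [AddCommGroup β] (e f : E) (g : (E → Bool) → β) :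
    D1 e (D1 f g) = D1 f (D1 e g) := by
  funext a; simp only [D1, opn_comm' a e f]; abel

theorem DG_empty' {β : Type*} [AddCommGroup β] (g : (E → Bool) → β) : DG ∅ g = g := by
  simp [DG]

theorem DG_insert' {β : Type*} [AddCommGroup β] (e : E) (F : Finset E) (he : e ∉ F)
    (g : (E → Bool) → β) : DG (insert e F) g = D1 e (DG F g) := by
  have : LeftCommutative (D1 (E := E) (β := β)) := ⟨fun a b c => D1_comm' a b c⟩
  exact (Finset.toList_insert he).foldr_eq g

theorem DG_zero_of_mem {β : Type*} [AddCommGroup β] (e : E) (F : Finset E) (he : e ∈ F)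
    (g : (E → Bool) → β) (a : E → Bool) : DG F g (opn a {e}) = 0 := by
  rw [← Finset.insert_erase he, DG_insert' _ _ (Finset.notMem_erase e F)]
  simp [D1, opn_idem']

theorem DG_map' {β γ : Type*} [AddCommGroup β] [AddCommGroup γ] (φ : β →+ γ) (F : Finset E)
    (g : (E → Bool) → β) : ∀ a, DG F (fun b => φ (g b)) a = φ (DG F g a) := by
  induction F using Finset.induction_on with
  | empty => intro a; simp [DG_empty']
  | insert e F he ih => intro a; simp [DG_insert' _ _ he, D1, ih]

theorem DG_sum' {ι β : Type*} [AddCommGroup β] (s : Finset ι) (F : Finset E)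
    (g : ι → (E → Bool) → β) :
    ∀ a, DG F (fun b => ∑ i ∈ s, g i b) a = ∑ i ∈ s, DG F (g i) a := by
  induction F using Finset.induction_on with
  | empty => intro a; simp [DG_empty']
  | insert e F he ih => intro a; simp [DG_insert' _ _ he, D1, ih]

theorem DG_leibniz (w g : (E → Bool) → ℝ)
    (hw : ∀ e f : E, e ≠ f → ∀ a, D1 f w (opn a {e}) = D1 f w a) (F : Finset E) :
    ∀ a, DG F (fun b => w b * g b) a = w a * DG F g a
      + ∑ e ∈ F, D1 e w a * DG (F.erase e) g (opn a {e}) := by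
  induction F using Finset.induction_on with
  | empty => intro a; simp [DG_empty']
  | insert e F he ih =>
    intro a
    rw [DG_insert' _ _ he, DG_insert' _ _ he, Finset.sum_insert he, Finset.erase_insert he]
    have h : ∀ f ∈ F, D1 f w a * DG ((insert e F).erase f) g (opn a {f})
        = D1 f w (opn a {e}) * DG (F.erase f) g (opn (opn a {e}) {f})
          - D1 f w a * DG (F.erase f) g (opn a {f}) := by
      intro f hf
      have hef : e ≠ f := fun h => he (h ▸ hf)
      rw [Finset.erase_insert_of_ne hef,
        DG_insert' _ _ (fun h => he (Finset.mem_of_mem_erase h)), hw e f hef, opn_comm' a e f]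
      simp only [D1]; ring
    rw [Finset.sum_congr rfl h, Finset.sum_sub_distrib]
    simp only [D1] at ih ⊢
    rw [ih, ih]
    ring

theorem sum_erase_reindex [Fintype E] (m : ℕ) (h : E → Finset E → ℝ)
    (h0 : ∀ e F, e ∈ F → h e F = 0) :
    ∑ F ∈ (Finset.univ : Finset E).powersetCard (m + 1), ∑ e ∈ F, h e (F.erase e)
      = ∑ e, ∑ F ∈ (Finset.univ : Finset E).powersetCard m, h e F := by
  have h1 : ∀ e, ∑ F ∈ (Finset.univ : Finset E).powersetCard m, h e F
      = ∑ F ∈ ((Finset.univ : Finset E).powersetCard m).filter (fun F => e ∉ F), h e F := by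
    intro e
    rw [Finset.sum_filter]
    refine Finset.sum_congr rfl fun F _ => ?_
    split_ifs with hh
    · exact h0 _ _ hh
    · rfl
  simp_rw [h1]
  rw [Finset.sum_sigma', Finset.sum_sigma']
  refine Finset.sum_bij' (fun p _ => ⟨p.2, p.1.erase p.2⟩) (fun p _ => ⟨insert p.1 p.2, p.1⟩)
    ?_ ?_ ?_ ?_ ?_
  · rintro ⟨F, e⟩ hp
    simp only [Finset.mem_sigma, Finset.mem_powersetCard_univ, Finset.mem_filter,
      Finset.mem_univ, true_and] at hp ⊢
    exact ⟨by rw [Finset.card_erase_of_mem hp.2, hp.1]; rfl, Finset.notMem_erase _ _⟩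
  · rintro ⟨e, F⟩ hp
    simp only [Finset.mem_sigma, Finset.mem_powersetCard_univ, Finset.mem_filter,
      Finset.mem_univ, true_and] at hp ⊢
    exact ⟨by rw [Finset.card_insert_of_notMem hp.2, hp.1], Finset.mem_insert_self _ _⟩
  · rintro ⟨F, e⟩ hp
    simp only [Finset.mem_sigma] at hp
    simp [Finset.insert_erase hp.2]
  · rintro ⟨e, F⟩ hp
    simp only [Finset.mem_sigma, Finset.mem_filter] at hp
    simp [Finset.erase_insert hp.2.2]
  · rintro ⟨F, e⟩ hp
    rfl

theorem ew_symm' {V : Type*} (G : SimpleGraph V) [DecidableRel G.Adj]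
    (b : G.edgeSet → Bool) (x y : V) : ew G b x y = ew G b y x := by
  unfold ew
  by_cases h : G.Adj x y
  · have h' := h.symm
    simp only [h, h', dif_pos, Sym2.eq_swap]
  · have h' : ¬ G.Adj y x := fun k => h k.symm
    simp only [h, h', dif_neg, not_false_iff]

theorem ew_affine {V : Type*} (G : SimpleGraph V) [DecidableRel G.Adj]
    [DecidableEq G.edgeSet] (x y : V) (e f : G.edgeSet) (hef : e ≠ f) (a : G.edgeSet → Bool) :
    D1 f (fun b => ew G b x y) (opn a {e}) = D1 f (fun b => ew G b x y) a := by
  simp only [D1, ew, opn, Finset.mem_singleton]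
  by_cases h : G.Adj x y
  · simp only [h, dif_pos]
    generalize (⟨s(x, y), (G.mem_edgeSet).mpr h⟩ : G.edgeSet) = c
    by_cases h1 : c = f
    · have h2 : c ≠ e := fun hh => hef (hh.symm.trans h1)
      simp [h1, hef.symm]
    · simp [h1]
  · simp [h]

theorem energy_eq {V : Type*} [Fintype V] (w : V → V → ℝ) (hw : ∀ x y, w x y = w y x)
    (V₀ : Set V) (ℓ u : V → ℝ) (hbd : ∀ x, x ∉ V₀ → u x = ℓ x)
    (hh : ∀ x ∈ V₀, ∑ y, w x y * (u y - u x) = 0) :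
    ∑ x, ∑ y, w x y * (u y - u x) * (u y - u x)
      = ∑ x, ∑ y, w x y * ((ℓ y - ℓ x) * (u y - u x)) := by
  have key : ∑ x, ∑ y, w x y * (u y - u x) * (u x - ℓ x) = 0 := by
    refine Finset.sum_eq_zero fun x _ => ?_
    rw [← Finset.sum_mul]
    by_cases hx : x ∈ V₀
    · rw [hh x hx, zero_mul]
    · rw [hbd x hx, sub_self, mul_zero]
  have key2 : ∑ x, ∑ y, w x y * (u y - u x) * (u y - ℓ y) = 0 := by
    rw [Finset.sum_comm, ← neg_eq_zero, ← key, ← Finset.sum_neg_distrib]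
    refine Finset.sum_congr rfl fun x _ => ?_
    rw [← Finset.sum_neg_distrib]
    refine Finset.sum_congr rfl fun y _ => ?_
    rw [hw y x]; ring
  rw [← sub_eq_zero, ← sub_zero (0 : ℝ)]
  nth_rewrite 2 [← key]
  rw [← key2]
  simp only [← Finset.sum_sub_distrib]
  refine Finset.sum_congr rfl fun x _ => Finset.sum_congr rfl fun y _ => ?_
  ring

/-- Lemma 3.3 of the paper.  Glauber expansion of the Dirichlet energy on a
finite simple graph: if for every configuration `b` the function `v(b)` equals `ℓ` off the
interior `V₀` and is `b`-harmonic on `V₀`, and `ℰ(b) := ⟨∇v(b), b·∇v(b)⟩`, then for `k ≥ 1`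
`∑_{|F|=k} (D_F ℰ)(a) = ⟨∇ℓ, a · ∑_{|F|=k} ∇((D_F v)(a))⟩
  + ∑_{e ∈ E} ⟨∇ℓ, (a^e − a) · ∑_{|G|=k−1} ∇((D_G v)(a^e))⟩`. -/
theorem glauber_expansion_dirichlet_energy {V : Type*} [Fintype V] [DecidableEq V]
    (G : SimpleGraph V) [DecidableRel G.Adj] [Fintype G.edgeSet]
    (V₀ : Set V) (ℓ : V → ℝ) (v : (G.edgeSet → Bool) → V → ℝ)
    (hbd : ∀ b : G.edgeSet → Bool, ∀ x, x ∉ V₀ → v b x = ℓ x)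
    (hharm : ∀ b : G.edgeSet → Bool, ∀ x ∈ V₀, ∑ y, ew G b x y * (v b y - v b x) = 0)
    (k : ℕ) (hk : 1 ≤ k) (a : G.edgeSet → Bool) :
    ∑ F ∈ (Finset.univ : Finset G.edgeSet).powersetCard k,
        DG F (fun b => (1 / 2 : ℝ) * ∑ x, ∑ y, ew G b x y * (v b y - v b x) * (v b y - v b x)) a
      = (1 / 2 : ℝ) * (∑ x, ∑ y, ew G a x y * (ℓ y - ℓ x) *
            ((∑ F ∈ (Finset.univ : Finset G.edgeSet).powersetCard k, DG F v a) y
              - (∑ F ∈ (Finset.univ : Finset G.edgeSet).powersetCard k, DG F v a) x))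
        + ∑ e : G.edgeSet,
            (1 / 2 : ℝ) * ∑ x, ∑ y, (ew G (opn a {e}) x y - ew G a x y) * (ℓ y - ℓ x) *
              ((∑ Gs ∈ (Finset.univ : Finset G.edgeSet).powersetCard (k - 1),
                  DG Gs v (opn a {e})) y
                - (∑ Gs ∈ (Finset.univ : Finset G.edgeSet).powersetCard (k - 1),
                    DG Gs v (opn a {e})) x) := by
  obtain ⟨m, rfl⟩ : ∃ m, k = m + 1 := ⟨k - 1, by omega⟩
  rw [Nat.add_sub_cancel]
  have hE : (fun b => (1 / 2 : ℝ) * ∑ x, ∑ y, ew G b x y * (v b y - v b x) * (v b y - v b x))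
      = fun b => ∑ x, ∑ y, ew G b x y * ((1 / 2 : ℝ) * (ℓ y - ℓ x) * (v b y - v b x)) := by
    funext b
    rw [energy_eq (ew G b) (ew_symm' G b) V₀ ℓ (v b) (hbd b) (hharm b)]
    simp only [Finset.mul_sum]
    refine Finset.sum_congr rfl fun x _ => Finset.sum_congr rfl fun y _ => ?_
    ring
  rw [hE]
  have hlin : ∀ (x y : V) (F : Finset G.edgeSet) (b : G.edgeSet → Bool),
      DG F (fun b => (1 / 2 : ℝ) * (ℓ y - ℓ x) * (v b y - v b x)) b
        = (1 / 2 : ℝ) * (ℓ y - ℓ x) * (DG F v b y - DG F v b x) := by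
    intro x y F b
    exact DG_map' ((AddMonoidHom.mulLeft ((1 / 2 : ℝ) * (ℓ y - ℓ x))).comp
      (Pi.evalAddMonoidHom (fun _ : V => ℝ) y - Pi.evalAddMonoidHom (fun _ : V => ℝ) x)) F v b
  have hF : ∀ F : Finset G.edgeSet,
      DG F (fun b => ∑ x, ∑ y, ew G b x y * ((1 / 2 : ℝ) * (ℓ y - ℓ x) * (v b y - v b x))) a
      = ∑ x, ∑ y, (ew G a x y * ((1 / 2 : ℝ) * (ℓ y - ℓ x) * (DG F v a y - DG F v a x))
        + ∑ e ∈ F, (ew G (opn a {e}) x y - ew G a x y) * ((1 / 2 : ℝ) * (ℓ y - ℓ x) *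
          (DG (F.erase e) v (opn a {e}) y - DG (F.erase e) v (opn a {e}) x))) := by
    intro F
    rw [DG_sum']
    refine Finset.sum_congr rfl fun x _ => ?_
    rw [DG_sum']
    refine Finset.sum_congr rfl fun y _ => ?_
    rw [DG_leibniz (fun b => ew G b x y) _ (ew_affine G x y)]
    simp only [hlin, D1]
  rw [Finset.sum_congr rfl fun F _ => hF F, Finset.sum_comm]
  simp only [Finset.mul_sum]
  rw [Finset.sum_comm (s := (Finset.univ : Finset G.edgeSet)), ← Finset.sum_add_distrib]
  refine Finset.sum_congr rfl fun x _ => ?_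
  rw [Finset.sum_comm, Finset.sum_comm (s := (Finset.univ : Finset G.edgeSet)),
    ← Finset.sum_add_distrib]
  refine Finset.sum_congr rfl fun y _ => ?_
  rw [Finset.sum_add_distrib,
    sum_erase_reindex m (fun e F => (ew G (opn a {e}) x y - ew G a x y) *
      ((1 / 2 : ℝ) * (ℓ y - ℓ x) * (DG F v (opn a {e}) y - DG F v (opn a {e}) x)))
      (fun e F he => by simp [DG_zero_of_mem e F he])]
  simp only [Finset.sum_apply, ← Finset.sum_sub_distrib, Finset.mul_sum]
  congr 1
  · refine Finset.sum_congr rfl fun F _ => ?_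
    ring
  · refine Finset.sum_congr rfl fun e _ => Finset.sum_congr rfl fun F _ => ?_
    ring
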